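/- arXiv:2012.08265 — 2 statements merged into one kernel-verified Lean document; each statement's English description precedes it below -/
import Mathlib

section
/- Let f be a probability density function supported on [m_L, ∞) for some m_L ∈ ℝ, positive and log-concave on its support, with finite mean, and let b ∈ ℝ. If b > 0, then for every integer N ≥ 1 there exists a unique equilibrium with N bins (i.e., unique edges m_L = m_0 < m_1 < ⋯ < m_{N−1} < m_N = ∞ satisfying m_k = (E[M | m_{k−1} ≤ M < m_k] + E[M | m_k ≤ M < m_{k+1}])/2 + b for k = 1,…,N−1). If b < 0, then there exists a positive integer N_max(b) such that an equilibrium with N bins exists if and only if 1 ≤ N ≤ N_max(b), and for each such N the equilibrium is unique. -/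
open MeasureTheory Set

/-- Conditional mean `E[M | M ∈ s]` of a random variable with density `f`. -/
noncomputable def condMean (f : ℝ → ℝ) (s : Set ℝ) : ℝ :=
  (∫ x in s, x * f x) / (∫ x in s, f x)

/-- The bin (interval) of real numbers between two extended-real edges `lo` and `hi`. -/
def ebin (lo hi : EReal) : Set ℝ := {x : ℝ | lo ≤ (x : EReal) ∧ (x : EReal) < hi}

/-- Edges `m_0 = m_L < m_1 < ⋯ < m_{N−1} < m_N = +∞` of an `N`-bin quantizer with interior
edges `m : Fin (N−1) → ℝ`, for a source supported on `[m_L, ∞)`. -/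
noncomputable def edgesL (mL : ℝ) (N : ℕ) (m : Fin (N - 1) → ℝ) (k : ℕ) : EReal :=
  if hk : k = 0 then (mL : EReal)
  else if h : k ≤ N - 1 then ((m ⟨k - 1, by omega⟩ : ℝ) : EReal)
  else ⊤

/-- `m : Fin (N−1) → ℝ` is the vector of interior edges of an `N`-bin cheap-talk equilibrium
for a source with density `f` supported on `[m_L, ∞)` and bias `b`: the interior edges are
strictly increasing, lie above `m_L`, and every interior edge `m_k` satisfies
`m_k = (E[M | m_{k−1} ≤ M < m_k] + E[M | m_k ≤ M < m_{k+1}])/2 + b`. -/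
def IsEqL (f : ℝ → ℝ) (mL b : ℝ) (N : ℕ) (m : Fin (N - 1) → ℝ) : Prop :=
  StrictMono m ∧ (∀ k, mL < m k) ∧ ∀ k : Fin (N - 1),
    m k = (condMean f (ebin (edgesL mL N m k.val) (edgesL mL N m (k.val + 1)))
         + condMean f (ebin (edgesL mL N m (k.val + 1)) (edgesL mL N m (k.val + 2)))) / 2 + b

/-- A positive, integrable, log-concave density on `[mL, ∞)` with finite mean. -/
structure LogConcaveSource (f : ℝ → ℝ) (mL : ℝ) : Prop where
  pos : ∀ x, mL ≤ x → 0 < f x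
  int : Integrable f
  lc : ConcaveOn ℝ (Ici mL) (fun x => Real.log (f x))
  mean : Integrable (fun x => x * f x)

/-- The conditional mean of the bin `[a, d)`, extended by `a` to empty bins. -/
noncomputable def binMean (f : ℝ → ℝ) (a : ℝ) (d : EReal) : ℝ :=
  open Classical in if (a : EReal) < d then condMean f (ebin a d) else a

lemma measurableSet_ebin (lo hi : EReal) : MeasurableSet (ebin lo hi) :=
  (measurableSet_Ico (a := lo) (b := hi)).preimage measurable_coe_real_ereal

lemma mem_ebin_coe {a x : ℝ} {d : EReal} : x ∈ ebin a d ↔ a ≤ x ∧ (x : EReal) < d := by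
  simp [ebin]

/-- Four-point inequality for concave functions. -/
lemma ConcaveOn.add_shift_le {g : ℝ → ℝ} {mL : ℝ} (hg : ConcaveOn ℝ (Ici mL) g)
    {x y t : ℝ} (hx : mL ≤ x) (hxy : x ≤ y) (ht : 0 ≤ t) :
    g x + g (y + t) ≤ g (x + t) + g y := by
  rcases eq_or_lt_of_le (show 0 ≤ y - x + t by linarith) with h | h
  · obtain rfl : y = x := by linarith
    linarith
  · have hyt : y + t ∈ Ici mL := by simp only [mem_Ici]; linarith
    have h1 : 0 ≤ t / (y - x + t) := by positivity
    have h2 : 0 ≤ (y - x) / (y - x + t) := div_nonneg (by linarith) h.le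
    have h3 : t / (y - x + t) + (y - x) / (y - x + t) = 1 := by field_simp; ring
    have e1 := hg.2 (x := x) (y := y + t) hx hyt h1 h2 h3
    have e2 := hg.2 (x := x) (y := y + t) hx hyt h2 h1 (by linarith)
    simp only [smul_eq_mul] at e1 e2
    have k1 : t / (y - x + t) * x + (y - x) / (y - x + t) * (y + t) = y := by
      field_simp; ring
    have k2 : (y - x) / (y - x + t) * x + t / (y - x + t) * (y + t) = x + t := by
      field_simp; ring
    rw [k1] at e1
    rw [k2] at e2
    have : (t / (y - x + t) + (y - x) / (y - x + t)) * (g x + g (y + t)) ≤ g (x + t) + g y := by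
      linarith
    rwa [h3, one_mul] at this

lemma binMean_of_le {f : ℝ → ℝ} {a : ℝ} {d : EReal} (h : d ≤ a) : binMean f a d = a :=
  if_neg (not_lt.2 h)

lemma setIntegral_ebin_pos {a : ℝ} {d : EReal} (had : (a : EReal) < d)
    {g : ℝ → ℝ} (hg : Integrable g) (hpos : ∀ x, a < x → (x : EReal) < d → 0 < g x) :
    0 < ∫ x in ebin a d, g x := by
  obtain ⟨c, hac, hcd⟩ := EReal.lt_iff_exists_real_btwn.1 had
  have hac' : a < c := by exact_mod_cast hac
  rw [setIntegral_pos_iff_support_of_nonneg_ae]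
  · refine lt_of_lt_of_le ?_ (measure_mono (s := Ioo a c) ?_)
    · simpa using hac'
    · intro x hx
      have hxd : (x : EReal) < d := lt_trans (by exact_mod_cast hx.2) hcd
      exact ⟨(hpos x hx.1 hxd).ne', mem_ebin_coe.2 ⟨hx.1.le, hxd⟩⟩
  · have hne : ∀ᵐ x ∂(volume.restrict (ebin a d)), x ≠ a :=
      ae_restrict_of_ae (by simp [ae_iff, measure_singleton])
    filter_upwards [ae_restrict_mem (measurableSet_ebin a d), hne] with x hx hxa
    exact (hpos x (lt_of_le_of_ne (mem_ebin_coe.1 hx).1 hxa.symm) (mem_ebin_coe.1 hx).2).le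
  · exact hg.integrableOn

namespace LogConcaveSource

variable {f : ℝ → ℝ} {mL : ℝ}

lemma integrable_centered (h : LogConcaveSource f mL) (v : ℝ) :
    Integrable (fun x => (x - v) * f x) :=
  (h.mean.sub (h.int.const_mul v)).congr (ae_of_all _ fun x => by simp [sub_mul])

lemma integral_ebin_pos (h : LogConcaveSource f mL) {a : ℝ} {d : EReal} (ha : mL ≤ a)
    (had : (a : EReal) < d) : 0 < ∫ x in ebin a d, f x :=
  setIntegral_ebin_pos had h.int fun x hx _ => h.pos x (ha.trans hx.le)

lemma integral_centered (h : LogConcaveSource f mL) {a : ℝ} {d : EReal} (ha : mL ≤ a)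
    (had : (a : EReal) < d) (v : ℝ) :
    ∫ x in ebin a d, (x - v) * f x = (binMean f a d - v) * ∫ x in ebin a d, f x := by
  have hp := h.integral_ebin_pos ha had
  simp only [sub_mul, binMean, if_pos had, condMean]
  rw [integral_sub h.mean.integrableOn (h.int.const_mul v).integrableOn,
    integral_const_mul, div_mul_cancel₀ _ hp.ne']

lemma integral_centered_binMean (h : LogConcaveSource f mL) {a : ℝ} {d : EReal} (ha : mL ≤ a)
    (had : (a : EReal) < d) : ∫ x in ebin a d, (x - binMean f a d) * f x = 0 := by
  rw [h.integral_centered ha had, sub_self, zero_mul]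

lemma le_binMean_iff (h : LogConcaveSource f mL) {a : ℝ} {d : EReal} (ha : mL ≤ a)
    (had : (a : EReal) < d) (v : ℝ) :
    v ≤ binMean f a d ↔ 0 ≤ ∫ x in ebin a d, (x - v) * f x := by
  rw [h.integral_centered ha had, mul_nonneg_iff_of_pos_right (h.integral_ebin_pos ha had),
    sub_nonneg]

lemma lt_binMean_iff (h : LogConcaveSource f mL) {a : ℝ} {d : EReal} (ha : mL ≤ a)
    (had : (a : EReal) < d) (v : ℝ) :
    v < binMean f a d ↔ 0 < ∫ x in ebin a d, (x - v) * f x := by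
  rw [h.integral_centered ha had, mul_pos_iff_of_pos_right (h.integral_ebin_pos ha had),
    sub_pos]

lemma lt_binMean (h : LogConcaveSource f mL) {a : ℝ} {d : EReal} (ha : mL ≤ a)
    (had : (a : EReal) < d) : a < binMean f a d := by
  rw [h.lt_binMean_iff ha had]
  exact setIntegral_ebin_pos had (h.integrable_centered a) fun x hx _ =>
    mul_pos (sub_pos.2 hx) (h.pos x (ha.trans hx.le))

lemma le_binMean (h : LogConcaveSource f mL) {a : ℝ} (d : EReal) (ha : mL ≤ a) :
    a ≤ binMean f a d := by
  by_cases had : (a : EReal) < d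
  · exact (h.lt_binMean ha had).le
  · rw [binMean_of_le (not_lt.1 had)]

lemma binMean_lt (h : LogConcaveSource f mL) {a d : ℝ} (ha : mL ≤ a) (had : a < d) :
    binMean f a d < d := by
  have had' : (a : EReal) < d := by exact_mod_cast had
  rw [← not_le, h.le_binMean_iff ha had', not_le, ← neg_pos, ← integral_neg]
  refine setIntegral_ebin_pos had' (h.integrable_centered d).neg fun x hx hxd => ?_
  have hxd' : x < d := by exact_mod_cast hxd
  have := mul_pos (sub_pos.2 hxd') (h.pos x (ha.trans hx.le))
  linarith

lemma binMean_mono_right (h : LogConcaveSource f mL) {a : ℝ} {d d' : EReal} (ha : mL ≤ a)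
    (hd : d ≤ d') : binMean f a d ≤ binMean f a d' := by
  by_cases had : (a : EReal) < d
  swap
  · rw [binMean_of_le (not_lt.1 had)]
    exact h.le_binMean d' ha
  rcases eq_or_lt_of_le hd with rfl | hdd
  · rfl
  have hdtop : d ≠ ⊤ := (hdd.trans_le le_top).ne
  lift d to ℝ using ⟨hdtop, ((bot_le).trans_lt had).ne'⟩
  have had' : a < d := by exact_mod_cast had
  have hunion : ebin a d' = ebin a d ∪ ebin d d' := by
    ext x
    simp only [mem_union, mem_ebin_coe]
    constructor
    · rintro ⟨h1, h2⟩
      rcases lt_or_ge x d with h3 | h3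
      · exact Or.inl ⟨h1, by exact_mod_cast h3⟩
      · exact Or.inr ⟨h3, h2⟩
    · rintro (⟨h1, h2⟩ | ⟨h1, h2⟩)
      · exact ⟨h1, h2.trans hdd⟩
      · exact ⟨had'.le.trans h1, h2⟩
  have hdisj : Disjoint (ebin (a : EReal) d) (ebin d d') :=
    Set.disjoint_left.2 fun x hx hx' => not_le.2 hx.2 hx'.1
  rw [h.le_binMean_iff ha (had.trans hdd), hunion,
    setIntegral_union hdisj (measurableSet_ebin _ _) (h.integrable_centered _).integrableOn
      (h.integrable_centered _).integrableOn, h.integral_centered_binMean ha had, zero_add]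
  refine setIntegral_nonneg (measurableSet_ebin _ _) fun x hx => ?_
  have hx1 := (mem_ebin_coe.1 hx).1
  have := h.binMean_lt ha had'
  exact mul_nonneg (by linarith) (h.pos x (by linarith)).le

lemma binMean_lt_left (h : LogConcaveSource f mL) {a a' : ℝ} {d : EReal} (ha : mL ≤ a)
    (haa : a < a') (had : (a' : EReal) < d) : binMean f a d < binMean f a' d := by
  have haa' : (a : EReal) < a' := by exact_mod_cast haa
  have hunion : ebin a d = ebin a a' ∪ ebin a' d := by
    ext x
    simp only [mem_union, mem_ebin_coe]
    constructor
    · rintro ⟨h1, h2⟩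
      rcases lt_or_ge x a' with h3 | h3
      · exact Or.inl ⟨h1, by exact_mod_cast h3⟩
      · exact Or.inr ⟨h3, h2⟩
    · rintro (⟨h1, h2⟩ | ⟨h1, h2⟩)
      · exact ⟨h1, h2.trans had⟩
      · exact ⟨haa.le.trans h1, h2⟩
  have hdisj : Disjoint (ebin (a : EReal) a') (ebin a' d) :=
    Set.disjoint_left.2 fun x hx hx' => not_le.2 hx.2 hx'.1
  rw [← not_le, h.le_binMean_iff ha (haa'.trans had), hunion,
    setIntegral_union hdisj (measurableSet_ebin _ _) (h.integrable_centered _).integrableOn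
      (h.integrable_centered _).integrableOn,
    h.integral_centered_binMean (ha.trans haa.le) had, add_zero, not_le, ← neg_pos, ← integral_neg]
  refine setIntegral_ebin_pos haa' (h.integrable_centered _).neg fun x hx hxd => ?_
  have hxd' : x < a' := by exact_mod_cast hxd
  have h1 := h.lt_binMean (ha.trans haa.le) had
  have := mul_pos (sub_pos.2 (hxd'.trans h1)) (h.pos x (ha.trans hx.le))
  linarith

lemma binMean_mono (h : LogConcaveSource f mL) {a a' : ℝ} {d d' : EReal} (ha : mL ≤ a)
    (haa : a ≤ a') (hd : d ≤ d') : binMean f a d ≤ binMean f a' d' := by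
  refine le_trans ?_ (h.binMean_mono_right (ha.trans haa) hd)
  rcases eq_or_lt_of_le haa with rfl | haa
  · rfl
  by_cases ha'd : (a' : EReal) < d
  · exact (h.binMean_lt_left ha haa ha'd).le
  have hda := not_lt.1 ha'd
  rw [binMean_of_le hda]
  by_cases had : (a : EReal) < d
  · lift d to ℝ using ⟨(hda.trans_lt (EReal.coe_lt_top a')).ne, ((bot_le).trans_lt had).ne'⟩
    exact (h.binMean_lt ha (by exact_mod_cast had)).le.trans (by exact_mod_cast hda)
  · rw [binMean_of_le (not_lt.1 had)]
    exact haa.le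

lemma shift_mul_le (h : LogConcaveSource f mL) {x y t : ℝ} (hx : mL ≤ x) (hxy : x ≤ y)
    (ht : 0 ≤ t) : f x * f (y + t) ≤ f (x + t) * f y := by
  have p1 := h.pos x hx
  have p2 := h.pos y (hx.trans hxy)
  have p3 := h.pos (x + t) (by linarith)
  have p4 := h.pos (y + t) (by linarith)
  have := h.lc.add_shift_le hx hxy ht
  rw [← Real.log_mul p1.ne' p4.ne', ← Real.log_mul p3.ne' p2.ne'] at this
  exact (Real.log_le_log_iff (by positivity) (by positivity)).1 this

/-- Shifting a bin to the right by `t` moves its conditional mean by at most `t`. -/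
lemma binMean_shift_le (h : LogConcaveSource f mL) {a t : ℝ} (d : EReal) (ha : mL ≤ a)
    (ht : 0 ≤ t) : binMean f (a + t) (d + t) ≤ binMean f a d + t := by
  by_cases had : (a : EReal) < d
  swap
  · have hd := not_lt.1 had
    rw [binMean_of_le hd, binMean_of_le]
    push_cast
    gcongr
  have had' : ((a + t : ℝ) : EReal) < d + t := by
    push_cast
    exact EReal.add_lt_add_right_coe had t
  set v := binMean f a d with hv
  have hmv : mL ≤ v := ha.trans (h.le_binMean d ha)
  have hI := h.integral_ebin_pos (by linarith : mL ≤ a + t) had'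
  have key := h.integral_centered (by linarith : mL ≤ a + t) had' (v + t)
  have hpre : (fun x : ℝ => x + t) ⁻¹' ebin ((a + t : ℝ) : EReal) (d + t) = ebin a d := by
    ext x
    rw [mem_preimage, mem_ebin_coe, mem_ebin_coe, add_le_add_iff_right, EReal.coe_add]
    refine and_congr_right fun _ => ?_
    constructor
    · intro hx
      by_contra hc
      exact absurd hx (not_lt.2 (by gcongr; exact not_lt.1 hc))
    · exact fun hx => EReal.add_lt_add_right_coe hx t
  have hshift : ∫ x in ebin ((a + t : ℝ) : EReal) (d + t), (x - (v + t)) * f x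
      = ∫ x in ebin a d, (x - v) * f (x + t) := by
    rw [← (measurePreserving_add_right volume t).setIntegral_preimage_emb
      (measurableEmbedding_addRight t), hpre]
    simp only [add_sub_add_right_eq_sub]
  have hint : Integrable (fun x => (x - v) * f (x + t)) := by
    have := (h.integrable_centered (v + t)).comp_add_right t
    simpa only [add_sub_add_right_eq_sub] using this
  have hle : ∫ x in ebin a d, (x - v) * f (x + t)
      ≤ ∫ x in ebin a d, (f (v + t) / f v) * ((x - v) * f x) := by
    refine setIntegral_mono_on hint.integrableOn
      ((h.integrable_centered v).const_mul _).integrableOn (measurableSet_ebin _ _) fun x hx => ?_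
    have hx1 : mL ≤ x := ha.trans (mem_ebin_coe.1 hx).1
    have hfv := h.pos v hmv
    rw [div_mul_eq_mul_div, le_div_iff₀ hfv]
    rcases le_total x v with hxv | hxv
    · nlinarith [h.shift_mul_le hx1 hxv ht]
    · nlinarith [h.shift_mul_le hmv hxv ht]
  rw [integral_const_mul, h.integral_centered_binMean ha had, mul_zero, ← hshift, key] at hle
  by_contra hc
  exact absurd hle (not_le.2 (mul_pos (by linarith [not_le.1 hc]) hI))

/-- The mean residual life is largest at the left end point of the support. -/
lemma binMean_le_add (h : LogConcaveSource f mL) {a : ℝ} (d : EReal) (ha : mL ≤ a) :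
    binMean f a d ≤ a + (binMean f mL ⊤ - mL) := by
  have h1 := h.binMean_mono_right ha (le_top : d ≤ ⊤)
  have h2 := h.binMean_shift_le ⊤ le_rfl (sub_nonneg.2 ha)
  rw [EReal.top_add_coe, add_sub_cancel] at h2
  linarith

/-- Where the density is decreasing, the mean of a bin lies to the left of its midpoint. -/
lemma binMean_le_midpoint (h : LogConcaveSource f mL) {a d : ℝ} (ha : mL ≤ a) (had : a < d)
    (hf : AntitoneOn f (Ici a)) : binMean f a d ≤ (a + d) / 2 := by
  have had' : (a : EReal) < d := by exact_mod_cast had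
  have hbin : ebin a d = Ico a d := by
    ext x
    simp [mem_ebin_coe]
  set v := (a + d) / 2 with hv
  have hle : ∫ x in ebin a d, (x - v) * f x ≤ ∫ x in ebin a d, (x - v) * f v := by
    refine setIntegral_mono_on (h.integrable_centered v).integrableOn ?_
      (measurableSet_ebin _ _) fun x hx => ?_
    · rw [hbin]
      exact (Continuous.integrableOn_Icc (by fun_prop)).mono_set Ico_subset_Icc_self
    · have hx1 := (mem_ebin_coe.1 hx).1
      have hav : a ≤ v := by linarith
      rcases le_total x v with hxv | hxv
      · nlinarith [hf hx1 hav hxv]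
      · nlinarith [hf hav hx1 hxv]
  have hzero : ∫ x in ebin a d, (x - v) * f v = 0 := by
    rw [hbin, integral_Ico_eq_integral_Ioc, ← intervalIntegral.integral_of_le had.le]
    simp [hv]
    ring_nf
    simp
  rw [hzero, h.integral_centered ha had'] at hle
  by_contra hc
  exact absurd hle (not_le.2 (mul_pos (by linarith [not_le.1 hc]) (h.integral_ebin_pos ha had')))

lemma exists_antitoneOn (h : LogConcaveSource f mL) : ∃ Y, mL ≤ Y ∧ AntitoneOn f (Ici Y) := by
  obtain ⟨x, y, hx, hxy, hlt⟩ : ∃ x y, mL ≤ x ∧ x < y ∧ f y < f x := by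
    by_contra! hc
    have hconst : IntegrableOn (fun _ : ℝ => f mL) (Ici mL) := by
      refine Integrable.mono h.int.integrableOn aestronglyMeasurable_const ?_
      filter_upwards [ae_restrict_mem measurableSet_Ici] with z hz
      rw [Real.norm_of_nonneg (h.pos mL le_rfl).le, Real.norm_of_nonneg (h.pos z hz).le]
      rcases eq_or_lt_of_le (mem_Ici.1 hz) with rfl | hz'
      · rfl
      · exact hc mL z le_rfl hz'
    rw [integrableOn_const_iff] at hconst
    simp [(h.pos mL le_rfl).ne'] at hconst
  have hy : mL ≤ y := by linarith
  refine ⟨y, hy, fun z hz w hw hzw => ?_⟩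
  rcases eq_or_lt_of_le hzw with rfl | hzw
  · rfl
  rw [mem_Ici] at hz hw
  have hlog : Real.log (f y) < Real.log (f x) := Real.log_lt_log (h.pos y hy) hlt
  have hslope : Real.log (f z) ≤ Real.log (f y) := by
    rcases eq_or_lt_of_le hz with rfl | hyz
    · rfl
    have := h.lc.slope_anti_adjacent hx (mem_Ici.2 (hy.trans hz)) hxy hyz
    have h1 : (Real.log (f y) - Real.log (f x)) / (y - x) ≤ 0 :=
      div_nonpos_of_nonpos_of_nonneg (by linarith) (by linarith)
    have h2 := (div_le_iff₀ (by linarith : (0:ℝ) < z - y)).1 (this.trans h1)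
    linarith
  have := h.lc.slope_anti_adjacent hx (mem_Ici.2 (hy.trans hw)) (hxy.trans_le hz) hzw
  have h1 : (Real.log (f z) - Real.log (f x)) / (z - x) ≤ 0 :=
    div_nonpos_of_nonpos_of_nonneg (by linarith) (by linarith)
  have h2 := (div_le_iff₀ (by linarith : (0:ℝ) < w - z)).1 (this.trans h1)
  exact (Real.log_le_log_iff (h.pos w (hy.trans hw)) (h.pos z (hy.trans hz))).1 (by linarith)

end LogConcaveSource

/-- The edge sequence `e 0, …, e n, ∞`. -/
noncomputable def extEdge (n : ℕ) (e : ℕ → ℝ) (k : ℕ) : EReal := if k ≤ n then (e k : EReal) else ⊤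

/-- The conditional mean of the `k`-th bin of the edge sequence `e 0, …, e n, ∞`. -/
noncomputable def action (f : ℝ → ℝ) (n : ℕ) (e : ℕ → ℝ) (k : ℕ) : ℝ :=
  binMean f (e k) (extEdge n e (k + 1))

/-- The best response to the edge sequence `e 0, …, e n, ∞`. -/
noncomputable def response (f : ℝ → ℝ) (mL b : ℝ) (n : ℕ) (e : ℕ → ℝ) : ℕ → ℝ
  | 0 => mL
  | k + 1 => (action f n e k + action f n e (k + 1)) / 2 + b

/-- `e 0 ≤ ⋯ ≤ e n` are weakly increasing edges with `e 0 = mL`. -/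
structure IsEdgeSeq (mL : ℝ) (n : ℕ) (e : ℕ → ℝ) : Prop where
  zero : e 0 = mL
  mono : ∀ k < n, e k ≤ e (k + 1)

/-- `e 0 < ⋯ < e n` are the finite edges of an equilibrium with `n + 1` bins. -/
structure IsEqSeq (f : ℝ → ℝ) (mL b : ℝ) (n : ℕ) (e : ℕ → ℝ) : Prop where
  zero : e 0 = mL
  lt : ∀ k < n, e k < e (k + 1)
  eq : ∀ k < n, e (k + 1) = response f mL b n e (k + 1)

lemma extEdge_of_le {n k : ℕ} {e : ℕ → ℝ} (h : k ≤ n) : extEdge n e k = e k := if_pos h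

lemma extEdge_of_lt {n k : ℕ} {e : ℕ → ℝ} (h : n < k) : extEdge n e k = ⊤ := if_neg (not_le.2 h)

lemma action_of_lt {f : ℝ → ℝ} {n k : ℕ} {e : ℕ → ℝ} (h : k < n) :
    action f n e k = binMean f (e k) (e (k + 1)) := by
  rw [action, extEdge_of_le h]

lemma action_last {f : ℝ → ℝ} {n : ℕ} {e : ℕ → ℝ} : action f n e n = binMean f (e n) ⊤ := by
  rw [action, extEdge_of_lt n.lt_succ_self]

lemma extEdge_mono {n k : ℕ} {e e' : ℕ → ℝ} (h : ∀ k ≤ n, e k ≤ e' k) :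
    extEdge n e k ≤ extEdge n e' k := by
  rcases le_or_gt k n with hk | hk
  · rw [extEdge_of_le hk, extEdge_of_le hk]
    exact_mod_cast h k hk
  · rw [extEdge_of_lt hk, extEdge_of_lt hk]

namespace IsEdgeSeq

variable {f : ℝ → ℝ} {mL b : ℝ} {n : ℕ} {e e' : ℕ → ℝ}

lemma le (he : IsEdgeSeq mL n e) {k : ℕ} (hk : k ≤ n) : mL ≤ e k := by
  induction k with
  | zero => exact he.zero.ge
  | succ k ih => exact (ih (by omega)).trans (he.mono k hk)

lemma extEdge_le_succ (he : IsEdgeSeq mL n e) (k : ℕ) : extEdge n e k ≤ extEdge n e (k + 1) := by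
  rcases lt_or_ge k n with hk | hk
  · rw [extEdge_of_le hk.le, extEdge_of_le hk]
    exact_mod_cast he.mono k hk
  · rw [extEdge_of_lt (by omega : n < k + 1)]
    exact le_top

lemma action_mono (h : LogConcaveSource f mL) (he : IsEdgeSeq mL n e)
    (hee : ∀ k ≤ n, e k ≤ e' k) {k : ℕ} (hk : k ≤ n) : action f n e k ≤ action f n e' k :=
  h.binMean_mono (he.le hk) (hee k hk) (extEdge_mono hee)

lemma action_le_succ (h : LogConcaveSource f mL) (he : IsEdgeSeq mL n e) {k : ℕ} (hk : k < n) :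
    action f n e k ≤ action f n e (k + 1) :=
  h.binMean_mono (he.le hk.le) (he.mono k hk) (he.extEdge_le_succ _)

lemma response_mono (h : LogConcaveSource f mL) (he : IsEdgeSeq mL n e)
    (hee : ∀ k ≤ n, e k ≤ e' k) {k : ℕ} (hk : k ≤ n) :
    response f mL b n e k ≤ response f mL b n e' k := by
  cases k with
  | zero => exact le_rfl
  | succ k =>
    have h1 := he.action_mono h hee (by omega : k ≤ n)
    have h2 := he.action_mono h hee hk
    simp only [response]
    linarith

end IsEdgeSeq

namespace IsEqSeq

variable {f : ℝ → ℝ} {mL b : ℝ} {n : ℕ} {e e' : ℕ → ℝ}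

lemma isEdgeSeq (he : IsEqSeq f mL b n e) : IsEdgeSeq mL n e :=
  ⟨he.zero, fun k hk => (he.lt k hk).le⟩

lemma action_succ (he : IsEqSeq f mL b n e) {k : ℕ} (hk : k < n) :
    action f n e (k + 1) - e (k + 1) = e (k + 1) - action f n e k - 2 * b := by
  have := he.eq k hk
  simp only [response] at this
  linarith

lemma gap_lt (h : LogConcaveSource f mL) (he : IsEqSeq f mL b n e) (he' : IsEqSeq f mL b n e')
    {k : ℕ} (hk : k < n) (h1 : e (k + 1) ≤ e' (k + 1))
    (h2 : e (k + 1) - e k < e' (k + 1) - e' k) :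
    action f n e (k + 1) - e (k + 1) < action f n e' (k + 1) - e' (k + 1) := by
  rw [he.action_succ hk, he'.action_succ hk]
  have ht := sub_nonneg.2 h1
  have h3 := h.binMean_shift_le (e (k + 1)) (he.isEdgeSeq.le hk.le) ht
  rw [← EReal.coe_add, add_sub_cancel] at h3
  have hlt := he.lt k hk
  have h4 := h.binMean_lt_left (a := e' k) (a' := e k + (e' (k + 1) - e (k + 1)))
    (d := e' (k + 1)) (he'.isEdgeSeq.le hk.le) (by linarith)
    (EReal.coe_lt_coe_iff.2 (by linarith))
  rw [action_of_lt hk, action_of_lt hk]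
  linarith

lemma false_of_lt (h : LogConcaveSource f mL) (he : IsEqSeq f mL b n e)
    (he' : IsEqSeq f mL b n e') {i : ℕ} (hi : i < n) (h1 : e i = e' i)
    (h2 : e (i + 1) < e' (i + 1)) : False := by
  have hstep : ∀ k, i ≤ k → k < n →
      e (k + 1) ≤ e' (k + 1) ∧ e (k + 1) - e k < e' (k + 1) - e' k := by
    intro k hik
    induction k, hik using Nat.le_induction with
    | base => exact fun _ => ⟨h2.le, by linarith⟩
    | succ k hik ih =>
      intro hk
      obtain ⟨h3, h4⟩ := ih (by omega)
      have hgap := he.gap_lt h he' (by omega : k < n) h3 h4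
      suffices hs : e (k + 1 + 1) - e (k + 1) < e' (k + 1 + 1) - e' (k + 1) from
        ⟨by linarith, hs⟩
      by_contra hc
      have h5 := h.binMean_shift_le (e (k + 1 + 1)) (he.isEdgeSeq.le hk.le) (sub_nonneg.2 h3)
      have h6 := h.binMean_mono_right (a := e' (k + 1)) (d := e' (k + 1 + 1))
        (d' := (e (k + 1 + 1) + (e' (k + 1) - e (k + 1)) : ℝ)) (he'.isEdgeSeq.le hk.le)
        (EReal.coe_le_coe_iff.2 (by linarith))
      rw [← EReal.coe_add, add_sub_cancel] at h5
      rw [action_of_lt hk, action_of_lt hk] at hgap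
      linarith
  obtain ⟨m, rfl⟩ : ∃ m, n = m + 1 := ⟨n - 1, by omega⟩
  obtain ⟨h3, h4⟩ := hstep m (by omega) (by omega)
  have hgap := he.gap_lt h he' (by omega : m < m + 1) h3 h4
  have h5 := h.binMean_shift_le ⊤ (he.isEdgeSeq.le le_rfl) (sub_nonneg.2 h3)
  rw [EReal.top_add_coe, add_sub_cancel] at h5
  rw [action_last, action_last] at hgap
  linarith

/-- Equilibria are unique. -/
lemma unique (h : LogConcaveSource f mL) (he : IsEqSeq f mL b n e) (he' : IsEqSeq f mL b n e')
    {k : ℕ} (hk : k ≤ n) : e k = e' k := by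
  induction k with
  | zero => rw [he.zero, he'.zero]
  | succ k ih =>
    have hk' := ih (by omega)
    rcases lt_trichotomy (e (k + 1)) (e' (k + 1)) with hlt | heq | hlt
    · exact (he.false_of_lt h he' hk hk' hlt).elim
    · exact heq
    · exact (he'.false_of_lt h he hk hk'.symm hlt).elim

end IsEqSeq

section existence

variable {f : ℝ → ℝ} {mL b : ℝ} {n : ℕ}

/-- A weakly increasing fixed point of the best response is strictly increasing. -/
lemma IsEdgeSeq.isEqSeq (h : LogConcaveSource f mL) {e : ℕ → ℝ} (he : IsEdgeSeq mL n e)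
    (hfix : ∀ k < n, e (k + 1) = response f mL b n e (k + 1)) (h0 : 0 < n → mL < e 1) :
    IsEqSeq f mL b n e := by
  refine ⟨he.zero, fun k hk => ?_, hfix⟩
  induction k with
  | zero => rw [he.zero]; exact h0 hk
  | succ k ih =>
    have hlt := ih (by omega)
    refine lt_of_le_of_ne (he.mono _ hk) fun heq => ?_
    have e1 := hfix k (by omega)
    have e2 := hfix (k + 1) hk
    simp only [response] at e1 e2
    have h1 : action f n e k < e (k + 1) := by
      rw [action_of_lt (by omega)]
      exact h.binMean_lt (he.le (by omega)) hlt
    have h2 : e (k + 2) ≤ action f n e (k + 2) := h.le_binMean _ (he.le hk)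
    linarith

/-- Monotone fixed point theorem for the best response: an equilibrium lies between a
subsolution and a supersolution. -/
lemma exists_isEqSeq (h : LogConcaveSource f mL) {lo hi : ℕ → ℝ} (hlo : IsEdgeSeq mL n lo)
    (hle : ∀ k ≤ n, lo k ≤ hi k)
    (hsub : ∀ k ≤ n, lo k ≤ response f mL b n lo k)
    (hsup : ∀ k ≤ n, response f mL b n hi k ≤ hi k) (h0 : 0 < n → mL < lo 1) :
    ∃ e, IsEqSeq f mL b n e := by
  let S : Set (ℕ → ℝ) := {e | IsEdgeSeq mL n e ∧
    ∀ k ≤ n, lo k ≤ e k ∧ e k ≤ hi k ∧ e k ≤ response f mL b n e k}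
  let s : ℕ → ℝ := fun k => sSup ((fun e => e k) '' S)
  have hloS : lo ∈ S := ⟨hlo, fun k hk => ⟨le_rfl, hle k hk, hsub k hk⟩⟩
  have hne : ∀ k, ((fun e : ℕ → ℝ => e k) '' S).Nonempty := fun k => ⟨lo k, lo, hloS, rfl⟩
  have hbdd : ∀ k ≤ n, BddAbove ((fun e : ℕ → ℝ => e k) '' S) := by
    rintro k hk
    refine ⟨hi k, ?_⟩
    rintro _ ⟨e, he, rfl⟩
    exact (he.2 k hk).2.1
  have hles : ∀ e ∈ S, ∀ k ≤ n, e k ≤ s k := fun e he k hk => le_csSup (hbdd k hk) ⟨e, he, rfl⟩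
  have hsle : ∀ k c, (∀ e ∈ S, e k ≤ c) → s k ≤ c := by
    intro k c hc
    refine csSup_le (hne k) ?_
    rintro _ ⟨e, he, rfl⟩
    exact hc e he
  have hs : IsEdgeSeq mL n s := by
    refine ⟨le_antisymm (hsle 0 _ fun e he => he.1.zero.le) ?_, fun k hk => ?_⟩
    · rw [← hlo.zero]
      exact hles lo hloS 0 (by omega)
    · exact hsle k _ fun e he => (he.1.mono k hk).trans (hles e he _ hk)
  have hsr : ∀ k ≤ n, s k ≤ response f mL b n s k := fun k hk =>
    hsle k _ fun e he => ((he.2 k hk).2.2).trans (he.1.response_mono h (hles e he) hk)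
  have hshi : ∀ k ≤ n, s k ≤ hi k := fun k hk => hsle k _ fun e he => (he.2 k hk).2.1
  have hr : IsEdgeSeq mL n (response f mL b n s) := by
    refine ⟨rfl, fun k hk => ?_⟩
    cases k with
    | zero => exact (hs.le hk).trans (hsr 1 hk)
    | succ k =>
      have h1 := hs.action_le_succ h (by omega : k < n)
      have h2 := hs.action_le_succ h hk
      simp only [response]
      linarith
  have hrS : response f mL b n s ∈ S :=
    ⟨hr, fun k hk => ⟨(hles lo hloS k hk).trans (hsr k hk),
      (hs.response_mono h hshi hk).trans (hsup k hk), hs.response_mono h hsr hk⟩⟩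
  exact ⟨s, hs.isEqSeq h (fun k hk => le_antisymm (hsr _ hk) (hles _ hrS _ hk))
    fun hn => (h0 hn).trans_le (hles lo hloS 1 hn)⟩

/-- For a positive bias there are equilibria with any number of bins. -/
lemma exists_isEqSeq_of_pos (h : LogConcaveSource f mL) (hb : 0 < b) (n : ℕ) :
    ∃ e, IsEqSeq f mL b n e := by
  set K := binMean f mL ⊤ - mL with hK
  have hK0 : 0 ≤ K := sub_nonneg.2 (h.le_binMean ⊤ le_rfl)
  have hlo : IsEdgeSeq mL n fun k => if k = 0 then mL else mL + b := by
    refine ⟨by simp, fun k _ => ?_⟩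
    simp only [Nat.succ_ne_zero, if_false]
    split_ifs <;> linarith
  have hhi : IsEdgeSeq mL n fun k => mL + k * (2 * K + 2 * b) := by
    refine ⟨by simp, fun k _ => ?_⟩
    push_cast
    linarith
  refine exists_isEqSeq h (hi := fun k => mL + k * (2 * K + 2 * b)) hlo
    (fun k _ => ?_) (fun k hk => ?_) (fun k hk => ?_)
    fun _ => by simpa using hb
  · cases k with
    | zero => simp
    | succ k =>
      have : (0 : ℝ) ≤ k * (2 * K + 2 * b) := by positivity
      simp only [Nat.succ_ne_zero, if_false]
      push_cast
      linarith
  · cases k with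
    | zero => simp [response]
    | succ k =>
      have h1 := h.le_binMean (extEdge n (fun k => if k = 0 then mL else mL + b) (k + 1))
        (hlo.le (by omega : k ≤ n))
      have h2 := h.le_binMean (extEdge n (fun k => if k = 0 then mL else mL + b) (k + 1 + 1))
        (hlo.le hk)
      have h3 := hlo.le (by omega : k ≤ n)
      simp only [response, action]
      simp only [Nat.succ_ne_zero, if_false] at h1 h2 h3 ⊢
      linarith
  · cases k with
    | zero => simp [response]
    | succ k =>
      have h1 := h.binMean_le_add (extEdge n (fun k => mL + k * (2 * K + 2 * b)) (k + 1))
        (hhi.le (by omega : k ≤ n))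
      have h2 := h.binMean_le_add (extEdge n (fun k => mL + k * (2 * K + 2 * b)) (k + 1 + 1))
        (hhi.le hk)
      simp only [response, action]
      push_cast at h1 h2 ⊢
      linarith

/-- If there is an equilibrium, there is one with one bin less. -/
lemma IsEqSeq.exists_pred (h : LogConcaveSource f mL) {e : ℕ → ℝ}
    (he : IsEqSeq f mL b (n + 1) e) : ∃ e', IsEqSeq f mL b n e' := by
  have hlo : IsEdgeSeq mL n e := ⟨he.zero, fun k hk => (he.lt k (by omega)).le⟩
  let hi : ℕ → ℝ := fun k => if k = 0 then mL else e (k + 1)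
  have hi_succ : ∀ k, hi (k + 1) = e (k + 2) := fun k => by simp [hi]
  have hhi0 : hi 0 = mL := by simp [hi]
  have hhi : IsEdgeSeq mL n hi := by
    refine ⟨hhi0, fun k hk => ?_⟩
    rw [hi_succ]
    cases k with
    | zero => rw [hhi0]; exact he.isEdgeSeq.le (by omega)
    | succ k => rw [hi_succ]; exact (he.lt (k + 2) (by omega)).le
  have hext : ∀ k, extEdge n hi (k + 1) = extEdge (n + 1) e (k + 2) := by
    intro k
    simp only [extEdge, hi_succ, show k + 2 ≤ n + 1 ↔ k + 1 ≤ n by omega]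
  have hact : ∀ k ≤ n, action f n hi k ≤ action f (n + 1) e (k + 1) := by
    intro k hk
    simp only [action, hext]
    refine h.binMean_mono (hhi.le hk) ?_ le_rfl
    cases k with
    | zero => rw [hhi0]; exact he.isEdgeSeq.le (by omega)
    | succ k => rw [hi_succ]
  have hact' : ∀ k ≤ n, action f (n + 1) e k ≤ action f n e k := by
    intro k hk
    refine h.binMean_mono_right (hlo.le hk) ?_
    rcases lt_or_ge k n with hk' | hk'
    · rw [extEdge_of_le (by omega), extEdge_of_le hk']
    · rw [extEdge_of_lt (by omega : n < k + 1)]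
      exact le_top
  refine exists_isEqSeq h (hi := hi) hlo (fun k hk => ?_) (fun k hk => ?_) (fun k hk => ?_)
    fun hn => ?_
  · cases k with
    | zero => rw [hhi0, he.zero]
    | succ k => rw [hi_succ]; exact (he.lt (k + 1) (by omega)).le
  · cases k with
    | zero => exact he.zero.le
    | succ k =>
      have h1 := hact' k (by omega)
      have h2 := hact' (k + 1) hk
      have h3 := he.eq k (by omega)
      simp only [response] at h3 ⊢
      linarith
  · cases k with
    | zero => exact hhi0.ge
    | succ k =>
      have h1 := hact k (by omega)
      have h2 := hact (k + 1) hk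
      have h3 := he.eq (k + 1) (by omega)
      rw [hi_succ]
      simp only [response] at h3 ⊢
      linarith
  · have := he.lt 0 (by omega)
    rwa [he.zero] at this

/-- For a negative bias the number of bins of an equilibrium is bounded. -/
lemma exists_isEqSeq_bound (h : LogConcaveSource f mL) (hb : b < 0) :
    ∃ B : ℕ, ∀ n e, IsEqSeq f mL b n e → n < B := by
  obtain ⟨Y, hY, hanti⟩ := h.exists_antitoneOn
  set K := binMean f mL ⊤ - mL with hK
  obtain ⟨J, hJ⟩ := exists_nat_ge ((Y - mL) / (-2 * b))
  obtain ⟨P, hP⟩ := exists_nat_gt (K / (-2 * b))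
  have hβ : 0 < -2 * b := by linarith
  rw [div_le_iff₀ hβ] at hJ
  rw [div_lt_iff₀ hβ] at hP
  refine ⟨J + 1 + P, fun n e he => ?_⟩
  by_contra! hn
  have hgrow : ∀ j < n, mL + j * (-2 * b) ≤ e (j + 1) := by
    intro j
    induction j with
    | zero => exact fun hj => by simpa using he.isEdgeSeq.le hj
    | succ j ih =>
      intro hj
      have h1 := ih (by omega)
      have h2 := he.action_succ (by omega : j < n)
      have h3 : action f n e j < e (j + 1) := by
        rw [action_of_lt (by omega)]
        exact h.binMean_lt (he.isEdgeSeq.le (by omega)) (he.lt j (by omega))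
      have h4 : action f n e (j + 1) < e (j + 1 + 1) := by
        rw [action_of_lt hj]
        exact h.binMean_lt (he.isEdgeSeq.le (by omega)) (he.lt (j + 1) hj)
      push_cast
      linarith
  have hgap : ∀ p : ℕ, J + 1 + p ≤ n →
      p * (-2 * b) ≤ action f n e (J + 1 + p) - e (J + 1 + p) := by
    intro p
    induction p with
    | zero =>
      intro hp
      simpa [action] using h.le_binMean (extEdge n e (J + 1 + 1)) (he.isEdgeSeq.le hp)
    | succ p ih =>
      intro hp
      have h1 := ih (by omega)
      have h2 := he.action_succ (by omega : J + 1 + p < n)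
      have h3 := hgrow (J + p) (by omega)
      rw [show J + p + 1 = J + 1 + p by omega] at h3
      have h4 : Y ≤ e (J + 1 + p) := by
        have : (0 : ℝ) ≤ p * (-2 * b) := by positivity
        push_cast at h3
        linarith
      have h5 := h.binMean_le_midpoint (he.isEdgeSeq.le (by omega)) (he.lt (J + 1 + p) (by omega))
        (hanti.mono (Ici_subset_Ici.2 h4))
      rw [← action_of_lt (by omega : J + 1 + p < n)] at h5
      rw [← add_assoc]
      push_cast
      linarith
  have h1 := hgap P hn
  have h2 : action f n e (J + 1 + P) ≤ _ :=
    h.binMean_le_add (extEdge n e (J + 1 + P + 1)) (he.isEdgeSeq.le hn)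
  linarith

end existence

lemma isEqL_iff_isEqSeq {f : ℝ → ℝ} {mL b : ℝ} {n : ℕ} {m : Fin (n + 1 - 1) → ℝ} {e : ℕ → ℝ}
    (h0 : e 0 = mL) (he : ∀ i : Fin (n + 1 - 1), e (i + 1) = m i) :
    IsEqL f mL b (n + 1) m ↔ IsEqSeq f mL b n e := by
  have hedge : ∀ k, edgesL mL (n + 1) m k = extEdge n e k := by
    intro k
    cases k with
    | zero => simp [edgesL, extEdge, h0]
    | succ k =>
      by_cases hk : k + 1 ≤ n
      · have := he ⟨k, hk⟩
        simp only at this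
        simp [edgesL, extEdge, hk, this]
      · simp [edgesL, extEdge, hk]
  have hmean : (∀ k < n, e k < e (k + 1)) → ∀ k ≤ n,
      condMean f (ebin (extEdge n e k) (extEdge n e (k + 1))) = action f n e k := by
    intro hlt k hk
    rw [action, binMean, extEdge_of_le hk, if_pos]
    rcases lt_or_ge k n with hk' | hk'
    · rw [extEdge_of_le hk']
      exact_mod_cast hlt k hk'
    · rw [extEdge_of_lt (by omega : n < k + 1)]
      exact EReal.coe_lt_top _
  have hiff : (∀ k < n, e k < e (k + 1)) → ((∀ k : Fin (n + 1 - 1),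
      m k = (condMean f (ebin (edgesL mL (n + 1) m k.val) (edgesL mL (n + 1) m (k.val + 1)))
         + condMean f (ebin (edgesL mL (n + 1) m (k.val + 1))
            (edgesL mL (n + 1) m (k.val + 2)))) / 2 + b) ↔
      ∀ k < n, e (k + 1) = response f mL b n e (k + 1)) := by
    intro hlt
    simp only [hedge]
    refine ⟨fun H k hk => ?_, fun H k => ?_⟩
    · have := H ⟨k, hk⟩
      rw [← he, hmean hlt k hk.le, hmean hlt (k + 1) hk] at this
      exact this
    · have hk : (k : ℕ) < n := k.2
      rw [← he, hmean hlt k hk.le, hmean hlt (k + 1) hk]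
      exact H k hk
  have hlt : (StrictMono m ∧ ∀ k, mL < m k) ↔ ∀ k < n, e k < e (k + 1) := by
    constructor
    · rintro ⟨hm, hm0⟩ k hk
      cases k with
      | zero =>
        rw [h0]
        have := he ⟨0, hk⟩
        simp only at this
        rw [this]
        exact hm0 _
      | succ k =>
        have h1 := he ⟨k, by omega⟩
        have h2 := he ⟨k + 1, hk⟩
        simp only at h1 h2
        rw [h1, h2]
        exact hm (Fin.mk_lt_mk.2 k.lt_succ_self)
    · intro H
      have hmono : ∀ j, j ≤ n → ∀ i < j, e i < e j := by
        intro j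
        induction j with
        | zero => intro _ i hi; omega
        | succ j ih =>
          intro hj i hi
          rcases Nat.lt_succ_iff_lt_or_eq.1 hi with hi | rfl
          · exact (ih (by omega) i hi).trans (H j hj)
          · exact H i hj
      refine ⟨fun i j hij => ?_, fun k => ?_⟩
      · rw [← he, ← he]
        exact hmono _ j.2 _ (Nat.succ_lt_succ hij)
      · rw [← h0, ← he]
        exact hmono _ k.2 _ (Nat.succ_pos _)
  constructor
  · rintro ⟨h1, h2, h3⟩
    have := hlt.1 ⟨h1, h2⟩
    exact ⟨h0, this, (hiff this).1 h3⟩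
  · rintro ⟨-, h1, h2⟩
    obtain ⟨h3, h4⟩ := hlt.2 h1
    exact ⟨h3, h4, (hiff h1).2 h2⟩

lemma exists_isEqL_iff {f : ℝ → ℝ} {mL b : ℝ} {n : ℕ} :
    (∃ m : Fin (n + 1 - 1) → ℝ, IsEqL f mL b (n + 1) m) ↔ ∃ e, IsEqSeq f mL b n e := by
  constructor
  · rintro ⟨m, hm⟩
    refine ⟨fun k => if hk : 0 < k ∧ k ≤ n then m ⟨k - 1, by omega⟩ else mL, ?_⟩
    refine (isEqL_iff_isEqSeq (by simp) fun i => ?_).1 hm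
    have : (i : ℕ) + 1 ≤ n := i.2
    simp [this]
  · rintro ⟨e, he⟩
    exact ⟨fun i => e (i + 1), (isEqL_iff_isEqSeq he.zero fun _ => rfl).2 he⟩

lemma LogConcaveSource.isEqL_unique {f : ℝ → ℝ} {mL b : ℝ} (h : LogConcaveSource f mL) {n : ℕ}
    {m m' : Fin (n + 1 - 1) → ℝ} (hm : IsEqL f mL b (n + 1) m) (hm' : IsEqL f mL b (n + 1) m') :
    m = m' := by
  let edges (m : Fin (n + 1 - 1) → ℝ) (k : ℕ) : ℝ :=
    if hk : 0 < k ∧ k ≤ n then m ⟨k - 1, by omega⟩ else mL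
  have h0 : ∀ m, edges m 0 = mL := fun m => by simp [edges]
  have h1 : ∀ m, ∀ i : Fin (n + 1 - 1), edges m (i + 1) = m i := fun m i => by
    have : (i : ℕ) + 1 ≤ n := i.2
    simp [edges, this]
  funext i
  rw [← h1 m, ← h1 m']
  exact ((isEqL_iff_isEqSeq (h0 m) (h1 m)).1 hm).unique h
    ((isEqL_iff_isEqSeq (h0 m') (h1 m')).1 hm') i.2

/-- For a source with a log-concave density supported on `[m_L, ∞)`
(positive there) with finite mean: if `b > 0` there is a unique `N`-bin equilibrium for every
`N ≥ 1`; if `b < 0` there is an `N_max(b) ≥ 1` such that an `N`-bin equilibrium exists iff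
`1 ≤ N ≤ N_max(b)`, and it is unique for each such `N`. -/
theorem logConcave_semiUnbounded_equilibria (f : ℝ → ℝ) (mL b : ℝ)
    (hsupp : ∀ x, x < mL → f x = 0)
    (hpos : ∀ x, mL ≤ x → 0 < f x)
    (hint : Integrable f)
    (hpdf : ∫ x, f x = 1)
    (hlc : ConcaveOn ℝ (Ici mL) (fun x => Real.log (f x)))
    (hmean : Integrable (fun x => x * f x)) :
    (0 < b → ∀ N : ℕ, 1 ≤ N → ∃! m : Fin (N - 1) → ℝ, IsEqL f mL b N m) ∧
    (b < 0 → ∃ Nmax : ℕ, 0 < Nmax ∧ ∀ N : ℕ, 1 ≤ N →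
      (((∃ m : Fin (N - 1) → ℝ, IsEqL f mL b N m) ↔ N ≤ Nmax) ∧
        (N ≤ Nmax → ∃! m : Fin (N - 1) → ℝ, IsEqL f mL b N m))) := by
  have h : LogConcaveSource f mL := ⟨hpos, hint, hlc, hmean⟩
  refine ⟨fun hb N hN => ?_, fun hb => ?_⟩
  · obtain ⟨n, rfl⟩ : ∃ n, N = n + 1 := ⟨N - 1, by omega⟩
    obtain ⟨m, hm⟩ := exists_isEqL_iff.2 (exists_isEqSeq_of_pos h hb n)
    exact ⟨m, hm, fun m' hm' => h.isEqL_unique hm' hm⟩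
  · obtain ⟨B, hB⟩ := exists_isEqSeq_bound h hb
    let S : Set ℕ := {n | ∃ e, IsEqSeq f mL b n e}
    have hS0 : S.Nonempty := ⟨0, fun _ => mL, rfl, by simp, by simp⟩
    have hSb : BddAbove S := ⟨B, fun n ⟨e, he⟩ => (hB n e he).le⟩
    have hdown : ∀ n, n ≤ sSup S → n ∈ S := fun n hn =>
      Nat.decreasingInduction' (P := fun k => k ∈ S)
        (fun k _ _ ⟨_, he⟩ => he.exists_pred h) hn (Nat.sSup_mem hS0 hSb)
    have hiff : ∀ n, (∃ m : Fin (n + 1 - 1) → ℝ, IsEqL f mL b (n + 1) m) ↔ n + 1 ≤ sSup S + 1 :=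
      fun n => exists_isEqL_iff.trans
        ⟨fun hn => Nat.succ_le_succ (le_csSup hSb hn), fun hn => hdown n (by omega)⟩
    refine ⟨sSup S + 1, Nat.succ_pos _, fun N hN => ?_⟩
    obtain ⟨n, rfl⟩ : ∃ n, N = n + 1 := ⟨N - 1, by omega⟩
    refine ⟨hiff n, fun hn => ?_⟩
    obtain ⟨m, hm⟩ := (hiff n).2 hn
    exact ⟨m, hm, fun m' hm' => h.isEqL_unique hm' hm⟩
end

section
/- Let f be a probability density function supported on [m_L, ∞) for some m_L ∈ ℝ, positive and log-concave on its support, with mean μ = E[M], and let b ∈ ℝ. Then there exists m > m_L satisfying the two-bin equilibrium equation m = (E[M | M < m] + E[M | M ≥ m])/2 + b if and only if 2b > −(μ − m_L); moreover, when it exists, such m is unique. In other words, an informative equilibrium exists if and only if 2b > −(μ − m_L), and otherwise the only equilibrium is the non-informative (single-bin) one. -/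
open MeasureTheory Set

theorem setIntegral_sub_mul_eq_condMean {f : ℝ → ℝ} {s : Set ℝ} (hf : Integrable f)
    (hxf : Integrable fun x => x * f x) (hs : (∫ x in s, f x) ≠ 0) (c : ℝ) :
    ∫ x in s, (x - c) * f x = (condMean f s - c) * ∫ x in s, f x := by
  have h : ∫ x in s, (x - c) * f x = (∫ x in s, x * f x) - c * ∫ x in s, f x := by
    simp_rw [sub_mul]
    rw [integral_sub hxf.integrableOn (hf.const_mul c).integrableOn, integral_const_mul]
  rw [h, condMean]
  field_simp

theorem integrable_sub_mul {f : ℝ → ℝ} (hf : Integrable f)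
    (hxf : Integrable fun x => x * f x) (c : ℝ) : Integrable fun x => (x - c) * f x := by
  simp_rw [sub_mul]
  exact hxf.sub (hf.const_mul c)

theorem continuous_setIntegral_Iio {h : ℝ → ℝ} (hh : Integrable h) :
    Continuous fun m => ∫ x in Iio m, h x := by
  have key : (fun m => ∫ x in Iio m, h x) =
      fun m => (∫ x in Iic (0 : ℝ), h x) + ∫ x in (0 : ℝ)..m, h x := by
    funext m
    rw [← integral_Iic_eq_integral_Iio,
      ← intervalIntegral.integral_Iic_sub_Iic hh.integrableOn hh.integrableOn]
    ring
  rw [key]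
  exact continuous_const.add
    (intervalIntegral.continuous_primitive (fun _ _ => hh.intervalIntegrable) 0)

theorem continuous_setIntegral_Ici {h : ℝ → ℝ} (hh : Integrable h) :
    Continuous fun m => ∫ x in Ici m, h x := by
  have key : (fun m => ∫ x in Ici m, h x) = fun m => (∫ x, h x) - ∫ x in Iio m, h x := by
    funext m
    rw [← integral_add_compl (measurableSet_Iio (a := m)) hh, compl_Iio]
    ring
  rw [key]
  exact continuous_const.sub (continuous_setIntegral_Iio hh)

/-- A function whose logarithm is concave satisfies `f x * f y ≤ f u * f v` when `u`, `v` lie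
between `x` and `y` with the same sum. -/
theorem mul_le_mul_of_concaveOn_log {f : ℝ → ℝ} {a : ℝ} (hpos : ∀ x, a ≤ x → 0 < f x)
    (hlc : ConcaveOn ℝ (Ici a) fun x => Real.log (f x)) {x y u v : ℝ} (hx : a ≤ x)
    (hxu : x ≤ u) (hxv : x ≤ v) (h : x + y = u + v) : f x * f y ≤ f u * f v := by
  have hy : a ≤ y := by linarith
  have pu := hpos u (hx.trans hxu)
  have pv := hpos v (hx.trans hxv)
  rcases eq_or_lt_of_le (show x ≤ y by linarith) with hxy | hxy
  · obtain rfl : u = x := by linarith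
    obtain rfl : v = u := by linarith
    rw [← hxy]
  have hd : 0 < y - x := by linarith
  have hvy : v = x + y - u := by linarith
  have s1 : 0 ≤ (y - u) / (y - x) := div_nonneg (by linarith) hd.le
  have s2 : 0 ≤ (u - x) / (y - x) := div_nonneg (by linarith) hd.le
  have s3 : (y - u) / (y - x) + (u - x) / (y - x) = 1 := by field_simp; ring
  have e1 := hlc.2 (mem_Ici.2 hx) (mem_Ici.2 hy) s1 s2 s3
  have e2 := hlc.2 (mem_Ici.2 hx) (mem_Ici.2 hy) s2 s1 (by rw [add_comm, s3])
  simp only [smul_eq_mul] at e1 e2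
  have g1 : (y - u) / (y - x) * x + (u - x) / (y - x) * y = u := by field_simp; ring
  have g2 : (u - x) / (y - x) * x + (y - u) / (y - x) * y = v := by
    rw [hvy]; field_simp; ring
  rw [g1] at e1
  rw [g2] at e2
  have px := hpos x hx
  have py := hpos y hy
  rw [← Real.log_le_log_iff (mul_pos px py) (mul_pos pu pv),
    Real.log_mul px.ne' py.ne', Real.log_mul pu.ne' pv.ne']
  have : Real.log (f x) + Real.log (f y) =
      ((y - u) / (y - x) + (u - x) / (y - x)) * (Real.log (f x) + Real.log (f y)) := by
    rw [s3, one_mul]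
  linarith

/-- The likelihood ratio `f x / f (x - δ)` of a log-concave density is decreasing, so it crosses
the value `f (c + δ) / f c` at `c + δ`. -/
theorem sub_mul_mul_le_of_concaveOn_log {f : ℝ → ℝ} {a : ℝ} (hsupp : ∀ x, x < a → f x = 0)
    (hpos : ∀ x, a ≤ x → 0 < f x) (hlc : ConcaveOn ℝ (Ici a) fun x => Real.log (f x))
    {c δ : ℝ} (hc : a ≤ c) (hδ : 0 ≤ δ) (x : ℝ) :
    f c * ((x - (c + δ)) * f x) ≤ f (c + δ) * ((x - (c + δ)) * f (x - δ)) := by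
  rcases le_total (c + δ) x with h | h
  · have := mul_le_mul_of_concaveOn_log hpos hlc (x := c) (y := x) (u := c + δ) (v := x - δ)
      hc (by linarith) (by linarith) (by ring)
    nlinarith
  · have : f (x - δ) * f (c + δ) ≤ f x * f c := by
      rcases lt_or_ge (x - δ) a with hx | hx
      · rw [hsupp _ hx, zero_mul]
        refine mul_nonneg ?_ (hpos c hc).le
        rcases lt_or_ge x a with hx' | hx'
        · exact (hsupp x hx').ge
        · exact (hpos x hx').le
      · exact mul_le_mul_of_concaveOn_log hpos hlc hx (by linarith) (by linarith) (by ring)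
    nlinarith

theorem setIntegral_pos_of_Ioo_subset {g : ℝ → ℝ} {s : Set ℝ} (hs : MeasurableSet s)
    (hg : IntegrableOn g s) (hnn : ∀ x ∈ s, 0 ≤ g x) {c d : ℝ} (hcd : c < d)
    (hsub : Ioo c d ⊆ s) (hpos : ∀ x ∈ Ioo c d, 0 < g x) : 0 < ∫ x in s, g x := by
  rw [setIntegral_pos_iff_support_of_nonneg_ae
    ((ae_restrict_iff' hs).2 (Filter.Eventually.of_forall hnn)) hg]
  refine lt_of_lt_of_le ?_ (measure_mono (show Ioo c d ⊆ Function.support g ∩ s from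
    fun x hx => ⟨(hpos x hx).ne', hsub hx⟩))
  simpa using hcd

theorem setIntegral_Iio_comp_sub_right (g : ℝ → ℝ) (m δ : ℝ) :
    ∫ x in Iio (m + δ), g (x - δ) = ∫ x in Iio m, g x := by
  rw [← (measurePreserving_sub_right volume δ).setIntegral_preimage_emb
    (measurableEmbedding_subRight δ) g (Iio m)]
  simp

theorem setIntegral_Ici_comp_sub_right (g : ℝ → ℝ) (m δ : ℝ) :
    ∫ x in Ici (m + δ), g (x - δ) = ∫ x in Ici m, g x := by
  rw [← (measurePreserving_sub_right volume δ).setIntegral_preimage_emb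
    (measurableEmbedding_subRight δ) g (Ici m)]
  simp

section LogConcave

variable {f : ℝ → ℝ} {a m δ : ℝ}

theorem nonneg_of_support_Ici (hsupp : ∀ x, x < a → f x = 0) (hpos : ∀ x, a ≤ x → 0 < f x)
    (x : ℝ) : 0 ≤ f x := by
  rcases lt_or_ge x a with h | h
  · exact (hsupp x h).ge
  · exact (hpos x h).le

theorem setIntegral_Iio_pos (hsupp : ∀ x, x < a → f x = 0) (hpos : ∀ x, a ≤ x → 0 < f x)
    (hf : Integrable f) (hm : a < m) : 0 < ∫ x in Iio m, f x :=
  setIntegral_pos_of_Ioo_subset measurableSet_Iio hf.integrableOn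
    (fun x _ => nonneg_of_support_Ici hsupp hpos x) hm (fun _ hx => hx.2)
    fun x hx => hpos x hx.1.le

theorem setIntegral_Ici_pos (hpos : ∀ x, a ≤ x → 0 < f x)
    (hf : Integrable f) (hm : a ≤ m) : 0 < ∫ x in Ici m, f x :=
  setIntegral_pos_of_Ioo_subset measurableSet_Ici hf.integrableOn
    (fun x hx => (hpos x (hm.trans hx)).le) (lt_add_one m) (fun _ hx => hx.1.le)
    fun x hx => hpos x (hm.trans hx.1.le)

theorem condMean_Iio_lt (hsupp : ∀ x, x < a → f x = 0) (hpos : ∀ x, a ≤ x → 0 < f x)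
    (hf : Integrable f) (hxf : Integrable fun x => x * f x) (hm : a < m) :
    condMean f (Iio m) < m := by
  have hF := setIntegral_Iio_pos hsupp hpos hf hm
  have h : 0 < ∫ x in Iio m, -((x - m) * f x) :=
    setIntegral_pos_of_Ioo_subset measurableSet_Iio (integrable_sub_mul hf hxf m).neg.integrableOn
      (fun x hx => by
        have := nonneg_of_support_Ici hsupp hpos x
        have : x < m := hx
        nlinarith) hm (fun _ hx => hx.2)
      fun x hx => by
        have := hpos x hx.1.le
        have := hx.2
        nlinarith
  rw [integral_neg, setIntegral_sub_mul_eq_condMean hf hxf hF.ne'] at h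
  nlinarith

theorem le_condMean_Iio (hsupp : ∀ x, x < a → f x = 0) (hpos : ∀ x, a ≤ x → 0 < f x)
    (hf : Integrable f) (hxf : Integrable fun x => x * f x) (hm : a < m) :
    a ≤ condMean f (Iio m) := by
  have hF := setIntegral_Iio_pos hsupp hpos hf hm
  have h : 0 ≤ ∫ x in Iio m, (x - a) * f x := by
    refine setIntegral_nonneg measurableSet_Iio fun x _ => ?_
    rcases lt_or_ge x a with hx | hx
    · simp [hsupp x hx]
    · exact mul_nonneg (by linarith) (hpos x hx).le
  rw [setIntegral_sub_mul_eq_condMean hf hxf hF.ne'] at h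
  nlinarith

theorem le_condMean_Ici (hpos : ∀ x, a ≤ x → 0 < f x)
    (hf : Integrable f) (hxf : Integrable fun x => x * f x) (hm : a ≤ m) :
    m ≤ condMean f (Ici m) := by
  have hF := setIntegral_Ici_pos hpos hf hm
  have h : 0 ≤ ∫ x in Ici m, (x - m) * f x :=
    setIntegral_nonneg measurableSet_Ici fun x hx =>
      mul_nonneg (sub_nonneg.2 hx) (hpos x (hm.trans hx)).le
  rw [setIntegral_sub_mul_eq_condMean hf hxf hF.ne'] at h
  nlinarith

/-- `m - E[M | M < m]` is strictly increasing in `m`. -/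
theorem condMean_Iio_add_lt (hsupp : ∀ x, x < a → f x = 0) (hpos : ∀ x, a ≤ x → 0 < f x)
    (hf : Integrable f) (hxf : Integrable fun x => x * f x)
    (hlc : ConcaveOn ℝ (Ici a) fun x => Real.log (f x)) (hm : a < m) (hδ : 0 < δ) :
    condMean f (Iio (m + δ)) < condMean f (Iio m) + δ := by
  have hF := setIntegral_Iio_pos hsupp hpos hf hm
  have hF' := setIntegral_Iio_pos hsupp hpos hf (show a < m + δ by linarith)
  have hc := le_condMean_Iio hsupp hpos hf hxf hm
  set c := condMean f (Iio m) with hcdef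
  have i1 : Integrable fun x => f c * ((x - (c + δ)) * f x) :=
    (integrable_sub_mul hf hxf _).const_mul _
  have i2 : Integrable fun x => f (c + δ) * ((x - (c + δ)) * f (x - δ)) := by
    refine Integrable.const_mul ?_ _
    simpa only [sub_sub, add_comm δ c] using (integrable_sub_mul hf hxf c).comp_sub_right δ
  have e2 : ∫ x in Iio (m + δ), (x - (c + δ)) * f (x - δ) = 0 := by
    have := setIntegral_Iio_comp_sub_right (fun x => (x - c) * f x) m δ
    rw [setIntegral_sub_mul_eq_condMean hf hxf hF.ne', ← hcdef, sub_self, zero_mul] at this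
    simpa only [sub_sub, add_comm δ c] using this
  have h : 0 < ∫ x in Iio (m + δ), (f (c + δ) * ((x - (c + δ)) * f (x - δ)) -
      f c * ((x - (c + δ)) * f x)) := by
    refine setIntegral_pos_of_Ioo_subset measurableSet_Iio (i2.sub i1).integrableOn
      (fun x _ => sub_nonneg.2 (sub_mul_mul_le_of_concaveOn_log hsupp hpos hlc hc hδ.le x))
      (show a < a + δ by linarith)
      (fun x hx => mem_Iio.2 (by linarith [hx.2])) fun x hx => ?_
    have hx2 := hx.2
    rw [hsupp (x - δ) (by linarith)]
    have := mul_pos (hpos c hc) (mul_pos (show 0 < c + δ - x by linarith) (hpos x hx.1.le))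
    linarith
  rw [integral_sub i2.integrableOn i1.integrableOn, integral_const_mul, integral_const_mul, e2,
    setIntegral_sub_mul_eq_condMean hf hxf hF'.ne'] at h
  have h' : 0 < f c * ((c + δ - condMean f (Iio (m + δ))) * ∫ x in Iio (m + δ), f x) := by
    linarith
  have := pos_of_mul_pos_left (pos_of_mul_pos_right h' (hpos c hc).le) hF'.le
  linarith

/-- `E[M | M ≥ m] - m` is decreasing in `m`. -/
theorem condMean_Ici_add_le (hsupp : ∀ x, x < a → f x = 0) (hpos : ∀ x, a ≤ x → 0 < f x)
    (hf : Integrable f) (hxf : Integrable fun x => x * f x)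
    (hlc : ConcaveOn ℝ (Ici a) fun x => Real.log (f x)) (hm : a ≤ m) (hδ : 0 ≤ δ) :
    condMean f (Ici (m + δ)) ≤ condMean f (Ici m) + δ := by
  have hF := setIntegral_Ici_pos hpos hf hm
  have hF' := setIntegral_Ici_pos hpos hf (show a ≤ m + δ by linarith)
  have hc := hm.trans (le_condMean_Ici hpos hf hxf hm)
  set c := condMean f (Ici m) with hcdef
  have i1 : Integrable fun x => f c * ((x - (c + δ)) * f x) :=
    (integrable_sub_mul hf hxf _).const_mul _
  have i2 : Integrable fun x => f (c + δ) * ((x - (c + δ)) * f (x - δ)) := by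
    refine Integrable.const_mul ?_ _
    simpa only [sub_sub, add_comm δ c] using (integrable_sub_mul hf hxf c).comp_sub_right δ
  have e2 : ∫ x in Ici (m + δ), (x - (c + δ)) * f (x - δ) = 0 := by
    have := setIntegral_Ici_comp_sub_right (fun x => (x - c) * f x) m δ
    rw [setIntegral_sub_mul_eq_condMean hf hxf hF.ne', ← hcdef, sub_self, zero_mul] at this
    simpa only [sub_sub, add_comm δ c] using this
  have h := setIntegral_mono (s := Ici (m + δ)) i1.integrableOn i2.integrableOn
    fun x => sub_mul_mul_le_of_concaveOn_log hsupp hpos hlc hc hδ x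
  rw [integral_const_mul, integral_const_mul, e2,
    setIntegral_sub_mul_eq_condMean hf hxf hF'.ne'] at h
  by_contra! hlt
  have := mul_pos (hpos c hc) (mul_pos (sub_pos.2 hlt) hF')
  linarith

theorem mean_le_condMean_Ici (hpos : ∀ x, a ≤ x → 0 < f x) (hnn : ∀ x, 0 ≤ f x)
    (hf : Integrable f) (hxf : Integrable fun x => x * f x) (hpdf : ∫ x, f x = 1) (hm : a ≤ m) :
    ∫ x, x * f x ≤ condMean f (Ici m) := by
  have hF := setIntegral_Ici_pos hpos hf hm
  set μ := ∫ x, x * f x with hμ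
  by_cases hμm : μ ≤ m
  · exact hμm.trans (le_condMean_Ici hpos hf hxf hm)
  have h0 : ∫ x, (x - μ) * f x = 0 := by
    simp_rw [sub_mul]
    rw [integral_sub hxf (hf.const_mul μ), integral_const_mul, hpdf, ← hμ]
    ring
  have h1 := integral_add_compl (measurableSet_Iio (a := m)) (integrable_sub_mul hf hxf μ)
  rw [compl_Iio, h0, setIntegral_sub_mul_eq_condMean hf hxf hF.ne'] at h1
  have h2 : ∫ x in Iio m, (x - μ) * f x ≤ 0 :=
    setIntegral_nonpos measurableSet_Iio fun x hx =>
      mul_nonpos_of_nonpos_of_nonneg (by linarith [mem_Iio.1 hx]) (hnn x)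
  nlinarith

theorem condMean_Iio_le_mean (hsupp : ∀ x, x < a → f x = 0) (hpos : ∀ x, a ≤ x → 0 < f x)
    (hf : Integrable f) (hxf : Integrable fun x => x * f x) (hpdf : ∫ x, f x = 1) (hm : a < m) :
    condMean f (Iio m) ≤ ∫ x, x * f x := by
  have hF := setIntegral_Iio_pos hsupp hpos hf hm
  have hG := setIntegral_Ici_pos hpos hf hm.le
  have hr := mean_le_condMean_Ici hpos (nonneg_of_support_Ici hsupp hpos) hf hxf hpdf hm.le
  set μ := ∫ x, x * f x with hμ
  have h0 : ∫ x, (x - μ) * f x = 0 := by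
    simp_rw [sub_mul]
    rw [integral_sub hxf (hf.const_mul μ), integral_const_mul, hpdf, ← hμ]
    ring
  have h1 := integral_add_compl (measurableSet_Iio (a := m)) (integrable_sub_mul hf hxf μ)
  rw [compl_Iio, h0, setIntegral_sub_mul_eq_condMean hf hxf hF.ne',
    setIntegral_sub_mul_eq_condMean hf hxf hG.ne'] at h1
  nlinarith

theorem condMean_Ici_support (hsupp : ∀ x, x < a → f x = 0) (hpdf : ∫ x, f x = 1) :
    condMean f (Ici a) = ∫ x, x * f x := by
  rw [condMean, setIntegral_eq_integral_of_forall_compl_eq_zero,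
    setIntegral_eq_integral_of_forall_compl_eq_zero, hpdf, div_one]
  · exact fun x hx => hsupp x (not_le.1 hx)
  · exact fun x hx => by rw [hsupp x (not_le.1 hx), mul_zero]

end LogConcave

/-- For a source with a log-concave density supported on `[m_L, ∞)`
(positive there) with mean `μ`: a two-bin equilibrium edge `m > m_L` with
`m = (E[M | M < m] + E[M | M ≥ m])/2 + b` exists iff `2b > −(μ − m_L)`, and it is unique
when it exists (otherwise the only equilibrium is the non-informative one). -/
theorem logConcave_semiUnbounded_informative_iff (f : ℝ → ℝ) (mL b μ : ℝ)
    (hsupp : ∀ x, x < mL → f x = 0)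
    (hpos : ∀ x, mL ≤ x → 0 < f x)
    (hint : Integrable f)
    (hpdf : ∫ x, f x = 1)
    (hlc : ConcaveOn ℝ (Ici mL) (fun x => Real.log (f x)))
    (hmean : Integrable (fun x => x * f x))
    (hμ : μ = ∫ x, x * f x) :
    ((∃ m : ℝ, mL < m ∧ m = (condMean f (Iio m) + condMean f (Ici m)) / 2 + b) ↔
      2 * b > -(μ - mL)) ∧
    (∀ m m' : ℝ,
      (mL < m ∧ m = (condMean f (Iio m) + condMean f (Ici m)) / 2 + b) →
      (mL < m' ∧ m' = (condMean f (Iio m') + condMean f (Ici m')) / 2 + b) →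
      m = m') := by
  have hnn := nonneg_of_support_Ici hsupp hpos
  set g : ℝ → ℝ := fun m => 2 * m - condMean f (Iio m) - condMean f (Ici m) with hg
  have heq : ∀ m, m = (condMean f (Iio m) + condMean f (Ici m)) / 2 + b ↔ g m = 2 * b := by
    intro m
    simp only [hg]
    constructor <;> intro h <;> linarith
  have hmono : StrictMonoOn g (Ioi mL) := by
    intro m hm m' _ hlt
    obtain ⟨δ, hδ, rfl⟩ : ∃ δ, 0 < δ ∧ m' = m + δ := ⟨m' - m, by linarith, by ring⟩
    have h1 := condMean_Iio_add_lt hsupp hpos hint hmean hlc hm hδ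
    have h2 := condMean_Ici_add_le hsupp hpos hint hmean hlc (le_of_lt hm) hδ.le
    simp only [hg]
    linarith
  have hres : ∀ m, mL < m → condMean f (Ici m) ≤ μ + (m - mL) := by
    intro m hm
    have h := condMean_Ici_add_le hsupp hpos hint hmean hlc le_rfl (sub_pos.2 hm).le
    rwa [condMean_Ici_support hsupp hpdf, ← hμ, add_sub_cancel] at h
  have hcont : ContinuousOn g (Ioi mL) := by
    have hl : ContinuousOn (fun m => condMean f (Iio m)) (Ioi mL) :=
      (continuous_setIntegral_Iio hmean).continuousOn.div
        (continuous_setIntegral_Iio hint).continuousOn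
        fun m hm => (setIntegral_Iio_pos hsupp hpos hint hm).ne'
    have hr : ContinuousOn (fun m => condMean f (Ici m)) (Ioi mL) :=
      (continuous_setIntegral_Ici hmean).continuousOn.div
        (continuous_setIntegral_Ici hint).continuousOn
        fun m hm => (setIntegral_Ici_pos hpos hint (le_of_lt hm)).ne'
    exact ((continuous_const.mul continuous_id).continuousOn.sub hl).sub hr
  simp only [heq]
  refine ⟨⟨?_, fun hb => ?_⟩, fun m m' h h' => hmono.injOn h.1 h'.1 (h.2.trans h'.2.symm)⟩
  · rintro ⟨m, hm, h⟩
    have h1 := condMean_Iio_lt hsupp hpos hint hmean hm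
    have h2 := hres m hm
    simp only [hg] at h
    linarith
  · obtain ⟨ε, hε, hεb⟩ : ∃ ε, 0 < ε ∧ 2 * ε ≤ 2 * b + (μ - mL) :=
      ⟨(2 * b + (μ - mL)) / 2, by linarith, by linarith⟩
    have hp : mL + ε ∈ Ioi mL := mem_Ioi.2 (by linarith)
    have hq : max (mL + 1) (2 * b + 2 * μ - mL) ∈ Ioi mL :=
      mem_Ioi.2 (lt_max_of_lt_left (by linarith))
    have hlow : g (mL + ε) ≤ 2 * b := by
      have h1 := le_condMean_Iio hsupp hpos hint hmean hp
      have h2 := mean_le_condMean_Ici hpos hnn hint hmean hpdf (le_of_lt hp)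
      rw [← hμ] at h2
      simp only [hg]
      linarith
    have hhigh : 2 * b ≤ g (max (mL + 1) (2 * b + 2 * μ - mL)) := by
      have h1 := condMean_Iio_le_mean hsupp hpos hint hmean hpdf hq
      have h2 := hres _ hq
      have h3 := le_max_right (mL + 1) (2 * b + 2 * μ - mL)
      rw [← hμ] at h1
      simp only [hg]
      linarith
    obtain ⟨m, hm, h⟩ := isPreconnected_Ioi.intermediate_value hp hq hcont ⟨hlow, hhigh⟩
    exact ⟨m, hm, h⟩
end
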